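/- (Inequality (25) in the proof of Proposition 3) Let d ≥ 2, n = d+1, and fix nonnegative integers ℓ₁, ℓ₂ with ℓ := ℓ₁+ℓ₂ < d and ℓ₁+1 ≤ d. For any code that satisfies node regeneration, message recovery (for parameter ℓ), and repair secrecy (for parameters ℓ₁, ℓ₂), one has H(U^{(ℓ₁+1,d)}) ≥ H(U^{(ℓ₁,ℓ)}) + Σ_{j=ℓ+1}^{d} B_j. -/

import Mathlib

open scoped BigOperators Classical

namespace MDCSR

noncomputable section

/-- `X` is a deterministic function of `Y`. -/
def IsFuncOf {Ω α β : Type*} (X : Ω → α) (Y : Ω → β) : Prop :=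
  ∃ f : β → α, ∀ ω, X ω = f (Y ω)

variable {Ω V : Type} [Fintype Ω]

/-- Probability of the event `X = x` under the probability mass function `p`. -/
def pm (p : Ω → ℝ) {α : Type*} (X : Ω → α) (x : α) : ℝ :=
  ∑ ω ∈ Finset.univ.filter (fun ω' => X ω' = x), p ω

/-- Shannon entropy of the random variable `X` under the probability mass function `p`. -/
def H (p : Ω → ℝ) {α : Type*} (X : Ω → α) : ℝ :=
  -∑ ω, p ω * Real.log (pm p X (X ω))

/-- An `(n = d+1, d)` code: messages `M 1, …, M d`, a key `K`, node contents
`W 1, …, W (d+1)`, and repair data `S i j` (data downloaded from node `i` to repair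
node `j`), all random variables on a common finite probability space `(Ω, p)`.
The messages are mutually independent, the key is independent of the messages,
each `W i` is a deterministic function of the messages and the key, and each
`S i j` is a deterministic function of `W i`. -/
structure Code (Ω V : Type) [Fintype Ω] (d : ℕ) : Type where
  p : Ω → ℝ
  p_nonneg : ∀ ω, 0 ≤ p ω
  p_sum : ∑ ω, p ω = 1
  M : ℕ → Ω → V
  K : Ω → V
  W : ℕ → Ω → V
  S : ℕ → ℕ → Ω → V
  M_indep : ∀ x : ℕ → V,
    pm p (fun ω (i : Fin d) => M (↑i + 1) ω) (fun i => x (↑i + 1)) =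
      ∏ i ∈ Finset.Icc 1 d, pm p (M i) (x i)
  K_indep : ∀ (k : V) (x : ℕ → V),
    pm p (fun ω => (K ω, fun (i : Fin d) => M (↑i + 1) ω)) (k, fun i => x (↑i + 1)) =
      pm p K k * pm p (fun ω (i : Fin d) => M (↑i + 1) ω) (fun i => x (↑i + 1))
  W_func : ∀ i ∈ Finset.Icc 1 (d + 1),
    IsFuncOf (W i) (fun ω => ((fun (j : Fin d) => M (↑j + 1) ω), K ω))
  S_func : ∀ i ∈ Finset.Icc 1 (d + 1), ∀ j ∈ Finset.Icc 1 (d + 1), i ≠ j →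
    IsFuncOf (S i j) (W i)

/-- Descriptors for the basic random variables of a code. -/
inductive Atom where
  | M : ℕ → Atom
  | K : Atom
  | W : ℕ → Atom
  | S : ℕ → ℕ → Atom

variable {d : ℕ}

/-- The random variable described by an atom. -/
def Code.atomRV (C : Code Ω V d) : Atom → Ω → V
  | .M i => C.M i
  | .K => C.K
  | .W i => C.W i
  | .S i j => C.S i j

/-- The joint random variable (tuple) described by a list of atoms. -/
def Code.rv (C : Code Ω V d) (L : List Atom) : Ω → List V :=
  fun ω => L.map fun a => C.atomRV a ω

/-- Joint entropy of a tuple of basic random variables. -/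
def Code.HL (C : Code Ω V d) (L : List Atom) : ℝ := H C.p (C.rv L)

/-- Conditional entropy `H(L₁ | L₂)`. -/
def Code.CH (C : Code Ω V d) (L₁ L₂ : List Atom) : ℝ := C.HL (L₁ ++ L₂) - C.HL L₂

/-- Mutual information `I(L₁ ; L₂)`. -/
def Code.MI (C : Code Ω V d) (L₁ L₂ : List Atom) : ℝ :=
  C.HL L₁ + C.HL L₂ - C.HL (L₁ ++ L₂)

/-- Relabeling of an atom along a permutation of the storage-node indices. -/
def Atom.perm (π : Equiv.Perm ℕ) : Atom → Atom
  | .M i => .M i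
  | .K => .K
  | .W i => .W (π i)
  | .S i j => .S (π i) (π j)

/-- A code is symmetrical if every joint entropy of a tuple of the basic random
variables is invariant under every permutation of the storage-node indices `[1:n]`. -/
def Code.Symmetrical (C : Code Ω V d) : Prop :=
  ∀ π : Equiv.Perm ℕ, (∀ i ∈ Finset.Icc 1 (d + 1), π i ∈ Finset.Icc 1 (d + 1)) →
    ∀ L : List Atom, C.HL (L.map (Atom.perm π)) = C.HL L

/-- The list `[a, a+1, …, b]`. -/
def icc (a b : ℕ) : List ℕ := List.range' a (b + 1 - a)

/-- `W_A` as a list of atoms. -/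
def Ws (A : List ℕ) : List Atom := A.map Atom.W

/-- `M_A` as a list of atoms. -/
def MsL (A : List ℕ) : List Atom := A.map Atom.M

/-- `M^{(m)} = (M_1, …, M_m)`. -/
def Mup (m : ℕ) : List Atom := MsL (icc 1 m)

/-- `S_{B → j}`. -/
def Sto (B : List ℕ) (j : ℕ) : List Atom := B.map fun i => Atom.S i j

/-- `S_{i → B}`. -/
def Sfrom (i : ℕ) (B : List ℕ) : List Atom := B.map fun j => Atom.S i j

/-- `S̄_{→ j} = S_{[j+1:n] → j}` (here `n = d+1`). -/
def SbarTo (d j : ℕ) : List Atom := Sto (icc (j + 1) (d + 1)) j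

/-- `S̄_{→ A}`. -/
def SbarToL (d : ℕ) (A : List ℕ) : List Atom := (A.map (SbarTo d)).flatten

/-- `S̲_{→ j} = S_{[1:j-1] → j}`. -/
def SunderTo (j : ℕ) : List Atom := Sto (icc 1 (j - 1)) j

/-- `S̲_{→ A}`. -/
def SunderToL (A : List ℕ) : List Atom := (A.map SunderTo).flatten

/-- `S_{→ j} = S_{([1:n] ∖ {j}) → j}` (here `n = d+1`). -/
def StoFull (d j : ℕ) : List Atom := Sto ((icc 1 (d + 1)).filter (fun i => i ≠ j)) j

/-- `(S_{→ j} : j ∈ A)`. -/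
def StoFullL (d : ℕ) (A : List ℕ) : List Atom := (A.map (StoFull d)).flatten

/-- `U^{(t,s)} = (W_{[1:t]}, S̄_{→[t+1:s]})`. -/
def U (d t s : ℕ) : List Atom := Ws (icc 1 t) ++ SbarToL d (icc (t + 1) s)

/-- Node regeneration: each `W j` is a deterministic function of `S_{→ j}`. -/
def Code.NodeRegen (C : Code Ω V d) : Prop :=
  ∀ j ∈ Finset.Icc 1 (d + 1), IsFuncOf (C.W j) (C.rv (StoFull d j))

/-- Message recovery for parameter `ℓ`: `M j` is constant for `j ∈ [1:ℓ]`, and for every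
`A ⊆ [1:n]` with `|A| ∈ [ℓ+1:d]`, `M_{|A|}` is a deterministic function of `W_A`. -/
def Code.MsgRecovery (C : Code Ω V d) (ℓ : ℕ) : Prop :=
  (∀ j ∈ Finset.Icc 1 ℓ, ∃ c : V, ∀ ω, C.M j ω = c) ∧
  ∀ A : Finset ℕ, A ⊆ Finset.Icc 1 (d + 1) → A.card ∈ Finset.Icc (ℓ + 1) d →
    IsFuncOf (C.M A.card) (C.rv (Ws (A.sort (· ≤ ·))))

/-- Repair secrecy for parameters `ℓ₁, ℓ₂`: for all disjoint `E₁, E₂ ⊆ [1:n]` with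
`|E₁| = ℓ₁`, `|E₂| = ℓ₂`, the messages `M_{ℓ+1}, …, M_d` are independent of
`((W_i : i ∈ E₁), (S_{→j} : j ∈ E₂))`, where `ℓ = ℓ₁ + ℓ₂`. -/
def Code.RepairSecrecy (C : Code Ω V d) (ℓ₁ ℓ₂ : ℕ) : Prop :=
  ∀ E₁ E₂ : Finset ℕ, E₁ ⊆ Finset.Icc 1 (d + 1) → E₂ ⊆ Finset.Icc 1 (d + 1) →
    Disjoint E₁ E₂ → E₁.card = ℓ₁ → E₂.card = ℓ₂ →
    C.MI (MsL (icc (ℓ₁ + ℓ₂ + 1) d))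
      (Ws (E₁.sort (· ≤ ·)) ++ StoFullL d (E₂.sort (· ≤ ·))) = 0

/-- `T_{d,k,ℓ} = Σ_{t=ℓ+1}^{k} (d+1−t)`, as a real number. -/
def T (d k ℓ : ℕ) : ℝ := ∑ t ∈ Finset.Icc (ℓ + 1) k, ((d : ℝ) + 1 - (t : ℝ))

theorem pm_self_pos {α : Type*} {p : Ω → ℝ} (hp : ∀ ω, 0 ≤ p ω) (X : Ω → α) {ω : Ω}
    (hω : 0 < p ω) : 0 < pm p X (X ω) :=
  Finset.sum_pos' (fun i _ => hp i) ⟨ω, by simp, hω⟩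

/-- Entropy does not increase when passing to a random variable determined by another one. -/
theorem H_le_of_determined {α β : Type*} {p : Ω → ℝ} (hp : ∀ ω, 0 ≤ p ω)
    {X : Ω → α} {Y : Ω → β} (h : ∀ ω ω', Y ω = Y ω' → X ω = X ω') : H p X ≤ H p Y := by
  refine neg_le_neg (Finset.sum_le_sum fun ω _ => ?_)
  rcases (hp ω).eq_or_lt with h0 | h0
  · simp [← h0]
  · refine mul_le_mul_of_nonneg_left (Real.log_le_log (pm_self_pos hp Y h0) ?_) h0.le
    refine Finset.sum_le_sum_of_subset_of_nonneg (fun ω' hω' => ?_) fun i _ _ => hp i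
    simp only [Finset.mem_filter, Finset.mem_univ, true_and] at hω' ⊢
    exact h _ _ hω'

theorem mem_icc {a b x : ℕ} : x ∈ icc a b ↔ a ≤ x ∧ x ≤ b := by
  simp only [icc, List.mem_range'_1]
  omega

theorem Code.rv_eq_iff (C : Code Ω V d) {L : List Atom} {ω ω' : Ω} :
    C.rv L ω = C.rv L ω' ↔ ∀ a ∈ L, C.atomRV a ω = C.atomRV a ω' :=
  List.map_inj_left

theorem Code.HL_le_of_determined (C : Code Ω V d) {L L' : List Atom}
    (h : ∀ ω ω', (∀ a ∈ L', C.atomRV a ω = C.atomRV a ω') →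
      ∀ a ∈ L, C.atomRV a ω = C.atomRV a ω') : C.HL L ≤ C.HL L' :=
  H_le_of_determined C.p_nonneg fun ω ω' hω => C.rv_eq_iff.2 (h ω ω' (C.rv_eq_iff.1 hω))

theorem Code.HL_singleton (C : Code Ω V d) (a : Atom) : C.HL [a] = H C.p (C.atomRV a) :=
  le_antisymm
    (H_le_of_determined C.p_nonneg fun ω ω' h => by simpa [Code.rv] using h)
    (H_le_of_determined C.p_nonneg fun ω ω' h => by simpa [Code.rv] using h)

theorem Code.H_messages (C : Code Ω V d) :
    H C.p (fun ω (i : Fin d) => C.M (↑i + 1) ω) = ∑ j ∈ Finset.Icc 1 d, H C.p (C.M j) := by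
  simp only [H, Finset.sum_neg_distrib]
  rw [Finset.sum_comm]
  congr 1
  refine Finset.sum_congr rfl fun ω _ => ?_
  rw [← Finset.mul_sum]
  rcases (C.p_nonneg ω).eq_or_lt with h0 | h0
  · simp [← h0]
  · rw [C.M_indep fun j => C.M j ω,
      Real.log_prod fun j _ => (pm_self_pos C.p_nonneg (C.M j) h0).ne']

theorem H_const {α : Type*} {p : Ω → ℝ} (hp : ∑ ω, p ω = 1) {X : Ω → α} {c : α}
    (h : ∀ ω, X ω = c) : H p X = 0 := by
  simp [H, pm, h, hp]

/-- Messages `M_{m+1}, …, M_d` have additive joint entropy when `M_1, …, M_m` are constant. -/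
theorem Code.sum_HL_message_le (C : Code Ω V d) {m : ℕ}
    (h : ∀ j ∈ Finset.Icc 1 m, ∃ c : V, ∀ ω, C.M j ω = c) :
    ∑ j ∈ Finset.Icc (m + 1) d, C.HL [Atom.M j] ≤ C.HL (MsL (icc (m + 1) d)) := by
  have hsum : ∑ j ∈ Finset.Icc (m + 1) d, C.HL [Atom.M j] =
      ∑ j ∈ Finset.Icc 1 d, H C.p (C.M j) := by
    simp only [C.HL_singleton, Code.atomRV]
    refine Finset.sum_subset (Finset.Icc_subset_Icc (by omega) le_rfl) fun j hj hj' => ?_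
    simp only [Finset.mem_Icc] at hj hj'
    obtain ⟨c, hc⟩ := h j (Finset.mem_Icc.2 (by omega))
    exact H_const C.p_sum hc
  rw [hsum, ← C.H_messages]
  refine H_le_of_determined C.p_nonneg fun ω ω' hω => funext fun i => ?_
  by_cases hi : (i : ℕ) + 1 ≤ m
  · obtain ⟨c, hc⟩ := h (i + 1) (Finset.mem_Icc.2 (by omega))
    rw [hc, hc]
  · exact C.rv_eq_iff.1 hω (Atom.M (i + 1))
      (List.mem_map_of_mem (mem_icc.2 (by omega)))

theorem Code.S_eq_of_W_eq (C : Code Ω V d) {i j : ℕ} (hi : i ∈ Finset.Icc 1 (d + 1))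
    (hj : j ∈ Finset.Icc 1 (d + 1)) (hij : i ≠ j) {ω ω' : Ω} (h : C.W i ω = C.W i ω') :
    C.S i j ω = C.S i j ω' := by
  obtain ⟨f, hf⟩ := C.S_func i hi j hj hij
  rw [hf, hf, h]

theorem Code.NodeRegen.W_eq {C : Code Ω V d} (hregen : C.NodeRegen) {j : ℕ}
    (hj : j ∈ Finset.Icc 1 (d + 1)) {ω ω' : Ω}
    (h : ∀ i ∈ Finset.Icc 1 (d + 1), i ≠ j → C.S i j ω = C.S i j ω') :
    C.W j ω = C.W j ω' := by
  obtain ⟨f, hf⟩ := hregen j hj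
  rw [hf, hf]
  congr 1
  refine C.rv_eq_iff.2 fun a ha => ?_
  simp only [StoFull, Sto, List.mem_map, List.mem_filter, mem_icc, decide_eq_true_eq] at ha
  obtain ⟨i, ⟨hi, hij⟩, rfl⟩ := ha
  exact h i (Finset.mem_Icc.2 hi) hij

theorem mem_U_W {t s i : ℕ} (h1 : 1 ≤ i) (hi : i ≤ t) : Atom.W i ∈ U d t s := by
  simp [U, Ws, mem_icc, h1, hi]

theorem mem_U_S {t s i j : ℕ} (hj : t + 1 ≤ j) (hjs : j ≤ s) (hij : j + 1 ≤ i)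
    (hi : i ≤ d + 1) : Atom.S i j ∈ U d t s := by
  refine List.mem_append_right _ (List.mem_flatten.2 ⟨SbarTo d j, ?_, ?_⟩)
  · exact List.mem_map_of_mem (mem_icc.2 ⟨hj, hjs⟩)
  · exact List.mem_map.2 ⟨i, mem_icc.2 ⟨hij, hi⟩, rfl⟩

/-- Under node regeneration, `U^{(t,d)}` determines the contents of all storage nodes. -/
theorem Code.NodeRegen.W_eq_of_U_eq {C : Code Ω V d} (hregen : C.NodeRegen) {t : ℕ} {ω ω' : Ω}
    (h : ∀ a ∈ U d t d, C.atomRV a ω = C.atomRV a ω') (j : ℕ)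
    (hj : j ∈ Finset.Icc 1 (d + 1)) : C.W j ω = C.W j ω' := by
  induction j using Nat.strong_induction_on with
  | _ j ih =>
    have hj' := Finset.mem_Icc.1 hj
    by_cases hjt : j ≤ t
    · exact h _ (mem_U_W hj'.1 hjt)
    · refine hregen.W_eq hj fun i hi hij => ?_
      have hi' := Finset.mem_Icc.1 hi
      rcases Nat.lt_or_gt_of_ne hij with hlt | hgt
      · exact C.S_eq_of_W_eq hi hj hij (ih i hlt hi)
      · exact h _ (mem_U_S (by omega) (by omega) (by omega) hi'.2)

theorem Code.MsgRecovery.M_eq {C : Code Ω V d} {ℓ : ℕ} (hrec : C.MsgRecovery ℓ) {ω ω' : Ω}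
    (h : ∀ j ∈ Finset.Icc 1 (d + 1), C.W j ω = C.W j ω') {j : ℕ}
    (hj : j ∈ Finset.Icc (ℓ + 1) d) : C.M j ω = C.M j ω' := by
  have hj' := Finset.mem_Icc.1 hj
  have hsub : Finset.Icc 1 j ⊆ Finset.Icc 1 (d + 1) := Finset.Icc_subset_Icc le_rfl (by omega)
  have hcard : (Finset.Icc 1 j).card = j := by simp
  obtain ⟨f, hf⟩ := hrec.2 (Finset.Icc 1 j) hsub (by rwa [hcard])
  rw [hcard] at hf
  rw [hf, hf]
  congr 1
  refine C.rv_eq_iff.2 fun a ha => ?_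
  obtain ⟨i, hi, rfl⟩ := List.mem_map.1 ha
  exact h i (hsub ((Finset.mem_sort _).1 hi))

theorem statement18 {Ω V : Type} [Fintype Ω] {d : ℕ} (hd : 2 ≤ d)
    {ℓ₁ ℓ₂ ℓ : ℕ} (hℓdef : ℓ = ℓ₁ + ℓ₂) (hℓd : ℓ < d) (hℓ₁d : ℓ₁ + 1 ≤ d)
    (C : Code Ω V d) (hregen : C.NodeRegen)
    (hrec : C.MsgRecovery ℓ) (hsec : C.RepairSecrecy ℓ₁ ℓ₂) :
    C.HL (U d (ℓ₁ + 1) d) ≥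
      C.HL (U d ℓ₁ ℓ) + ∑ j ∈ Finset.Icc (ℓ + 1) d, C.HL [Atom.M j] := by
  have hS := hsec (Finset.Icc 1 ℓ₁) (Finset.Icc (ℓ₁ + 1) ℓ)
    (Finset.Icc_subset_Icc le_rfl (by omega)) (Finset.Icc_subset_Icc (by omega) (by omega))
    (Finset.disjoint_left.2 fun x hx hx' => by simp only [Finset.mem_Icc] at hx hx'; omega)
    (by simp) (by simp [hℓdef])
  rw [← hℓdef] at hS
  set E := Ws ((Finset.Icc 1 ℓ₁).sort (· ≤ ·)) ++
    StoFullL d ((Finset.Icc (ℓ₁ + 1) ℓ).sort (· ≤ ·)) with hE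
  have hUE : C.HL (U d ℓ₁ ℓ) ≤ C.HL E := by
    refine C.HL_le_of_determined fun ω ω' h a ha => h a ?_
    rcases List.mem_append.1 ha with ha | ha
    · obtain ⟨i, hi, rfl⟩ := List.mem_map.1 ha
      exact List.mem_append_left _ (List.mem_map_of_mem
        ((Finset.mem_sort _).2 (Finset.mem_Icc.2 (mem_icc.1 hi))))
    · obtain ⟨l, hl, hal⟩ := List.mem_flatten.1 ha
      obtain ⟨j, hj, rfl⟩ := List.mem_map.1 hl
      obtain ⟨i, hi, rfl⟩ := List.mem_map.1 hal
      refine List.mem_append_right _ (List.mem_flatten.2 ⟨StoFull d j, ?_, ?_⟩)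
      · exact List.mem_map_of_mem ((Finset.mem_sort _).2 (Finset.mem_Icc.2 (mem_icc.1 hj)))
      · refine List.mem_map.2 ⟨i, List.mem_filter.2 ⟨mem_icc.2 ?_, ?_⟩, rfl⟩
        · have := mem_icc.1 hi; omega
        · have := mem_icc.1 hi
          exact decide_eq_true (by omega)
  have hdet : C.HL (MsL (icc (ℓ + 1) d) ++ E) ≤ C.HL (U d (ℓ₁ + 1) d) := by
    refine C.HL_le_of_determined fun ω ω' h a ha => ?_
    have hW := hregen.W_eq_of_U_eq h
    rcases List.mem_append.1 ha with ha | ha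
    · obtain ⟨j, hj, rfl⟩ := List.mem_map.1 ha
      exact hrec.M_eq hW (Finset.mem_Icc.2 (mem_icc.1 hj))
    rcases List.mem_append.1 ha with ha | ha
    · obtain ⟨i, hi, rfl⟩ := List.mem_map.1 ha
      have := Finset.mem_Icc.1 ((Finset.mem_sort _).1 hi)
      exact hW i (Finset.mem_Icc.2 (by omega))
    · obtain ⟨l, hl, hal⟩ := List.mem_flatten.1 ha
      obtain ⟨j, hj, rfl⟩ := List.mem_map.1 hl
      obtain ⟨i, hi, rfl⟩ := List.mem_map.1 hal
      have hj' := Finset.mem_Icc.1 ((Finset.mem_sort _).1 hj)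
      obtain ⟨hi₁, hij⟩ := List.mem_filter.1 hi
      have hi₂ := Finset.mem_Icc.2 (mem_icc.1 hi₁)
      exact C.S_eq_of_W_eq hi₂ (Finset.mem_Icc.2 (by omega)) (of_decide_eq_true hij) (hW i hi₂)
  have hM := C.sum_HL_message_le hrec.1
  unfold Code.MI at hS
  linarith

end

end MDCSR
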